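/- arXiv:1909.10257 — 6 statements merged into one kernel-verified Lean document; each statement's English description precedes it below -/
import Mathlib

section
/- Define g(x) = ∫_I G(x,y) σ(dy) for x ∈ I. Let (C_i)_{i∈J} be an at most countable family of pairwise disjoint subintervals of I such that, for each i: (a) if there exists x ∈ I with x < y for all y ∈ C_i, then ∫_{C_i} φ dσ = 0, and (b) if there exists x ∈ I with x > y for all y ∈ C_i, then ∫_{C_i} ψ dσ = 0. Set S = I \ ⋃_{i∈J} C_i and define W(x) = ∫_S G(x,y) σ(dy). Then g(x) = W(x) for every x ∈ S. -/
open Set MeasureTheory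

/-- A point outside an order-connected set lies strictly below or strictly above all of it. -/
theorem Set.OrdConnected.forall_lt_or_forall_gt {α : Type*} [LinearOrder α] {s : Set α}
    (hs : s.OrdConnected) {x : α} (hx : x ∉ s) : (∀ y ∈ s, x < y) ∨ (∀ y ∈ s, y < x) := by
  by_contra! h
  obtain ⟨⟨y, hy, hyx⟩, ⟨z, hz, hxz⟩⟩ := h
  exact hx (hs.out hy hz ⟨hyx, hxz⟩)

/-- Integrability of `ψ * |f|` on a measurable set passes to `ψ * f` when `ψ` is continuous there. -/
theorem MeasureTheory.IntegrableOn.mul_of_mul_abs {I : Set ℝ} (hI : MeasurableSet I)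
    {m : Measure ℝ} {ψ f : ℝ → ℝ} (hψ : ContinuousOn ψ I) (hf : Measurable f)
    (h : IntegrableOn (fun y => ψ y * |f y|) I m) : IntegrableOn (fun y => ψ y * f y) I m :=
  Integrable.mono h ((hψ.aestronglyMeasurable hI).mul hf.aestronglyMeasurable)
    (Filter.Eventually.of_forall fun y => by simp)

/-- Removing countably many disjoint measurable pieces of vanishing integral does not change
the integral. -/
theorem MeasureTheory.setIntegral_diff_iUnion_of_setIntegral_eq_zero {α : Type*}
    [MeasurableSpace α] {m : Measure α} {h : α → ℝ} {I : Set α} {C : ℕ → Set α}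
    (hint : IntegrableOn h I m) (hC : ∀ i, MeasurableSet (C i)) (hCI : ∀ i, C i ⊆ I)
    (hdisj : Pairwise (Function.onFun Disjoint C)) (hzero : ∀ i, ∫ y in C i, h y ∂m = 0) :
    ∫ y in I \ ⋃ i, C i, h y ∂m = ∫ y in I, h y ∂m := by
  have hsub : ⋃ i, C i ⊆ I := iUnion_subset hCI
  rw [setIntegral_sdiff (MeasurableSet.iUnion hC) hint hsub,
    integral_iUnion hC hdisj (hint.mono_set hsub)]
  simp [hzero]

/-- Representation lemma: with `g(x) = ∫_I G(x,y) σ(dy)` and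
`W(x) = ∫_S G(x,y) σ(dy)`, where `S = I \ ⋃ᵢ Cᵢ` for an at most countable family of
pairwise disjoint subintervals `Cᵢ ⊆ I` satisfying (a) and (b), one has `g = W` on `S`.
The signed measure `σ` on `I` is represented as `σ(dy) = f(y) m(dy)`, and the
finiteness of `∫_I ψ d|σ|` and `∫_I φ d|σ|` as the corresponding integrability. -/
theorem stmt_0 (l r : EReal) (hlr : l < r)
    (I : Set ℝ) (hI : I = {x : ℝ | l < (x : EReal) ∧ (x : EReal) < r})
    (ψ φ : ℝ → ℝ) (w : ℝ) (hw : 0 < w)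
    (hψc : ContinuousOn ψ I) (hψ0 : ∀ x ∈ I, 0 < ψ x) (hψm : StrictMonoOn ψ I)
    (hφc : ContinuousOn φ I) (hφ0 : ∀ x ∈ I, 0 < φ x) (hφa : StrictAntiOn φ I)
    (G : ℝ → ℝ → ℝ)
    (hG : ∀ x y, G x y = if x ≤ y then w⁻¹ * ψ x * φ y else w⁻¹ * ψ y * φ x)
    (m : Measure ℝ) (f : ℝ → ℝ) (hf : Measurable f)
    (hintψ : IntegrableOn (fun y => ψ y * |f y|) I m)
    (hintφ : IntegrableOn (fun y => φ y * |f y|) I m)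
    (C : ℕ → Set ℝ) (hCI : ∀ i, C i ⊆ I) (hCord : ∀ i, (C i).OrdConnected)
    (hdisj : ∀ i j, i ≠ j → Disjoint (C i) (C j))
    (hCa : ∀ i, (∃ x ∈ I, ∀ y ∈ C i, x < y) → (∫ y in C i, φ y * f y ∂m) = 0)
    (hCb : ∀ i, (∃ x ∈ I, ∀ y ∈ C i, y < x) → (∫ y in C i, ψ y * f y ∂m) = 0)
    (S : Set ℝ) (hS : S = I \ ⋃ i, C i)
    (g W : ℝ → ℝ)
    (hg : ∀ x, g x = ∫ y in I, G x y * f y ∂m)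
    (hW : ∀ x, W x = ∫ y in S, G x y * f y ∂m) :
    ∀ x ∈ S, g x = W x := by
  have hIm : MeasurableSet I := by
    rw [hI]
    exact (measurable_coe_real_ereal measurableSet_Ioi).inter
      (measurable_coe_real_ereal measurableSet_Iio)
  have hψf := hintψ.mul_of_mul_abs hIm hψc hf
  have hφf := hintφ.mul_of_mul_abs hIm hφc hf
  intro x hxS
  rw [hS] at hxS
  obtain ⟨hxI, hxC⟩ := hxS
  have hright : ∀ y, x ≤ y → G x y * f y = w⁻¹ * ψ x * (φ y * f y) := fun y hy => by
    rw [hG, if_pos hy]; ring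
  have hleft : ∀ y, y < x → G x y * f y = w⁻¹ * φ x * (ψ y * f y) := fun y hy => by
    rw [hG, if_neg hy.not_ge]; ring
  have hint : IntegrableOn (fun y => G x y * f y) I m := by
    rw [← inter_union_compl I (Ici x)]
    refine IntegrableOn.union ?_ ?_
    · exact IntegrableOn.congr_fun
        ((hφf.mono_set inter_subset_left).const_mul (w⁻¹ * ψ x))
        (fun y hy => (hright y hy.2).symm) (hIm.inter measurableSet_Ici)
    · exact IntegrableOn.congr_fun
        ((hψf.mono_set inter_subset_left).const_mul (w⁻¹ * φ x))
        (fun y hy => (hleft y (not_le.mp hy.2)).symm) (hIm.inter measurableSet_Ici.compl)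
  have hCm : ∀ i, MeasurableSet (C i) := fun i => (hCord i).measurableSet
  rw [hg, hW, hS]
  refine (setIntegral_diff_iUnion_of_setIntegral_eq_zero hint hCm hCI
    (fun i j hij => hdisj i j hij) fun i => ?_).symm
  rcases (hCord i).forall_lt_or_forall_gt fun h => hxC (mem_iUnion_of_mem i h) with h | h
  · rw [setIntegral_congr_fun (hCm i) fun y hy => hright y (h y hy).le, integral_const_mul,
      hCa i ⟨x, hxI, h⟩, mul_zero]
  · rw [setIntegral_congr_fun (hCm i) fun y hy => hleft y (h y hy), integral_const_mul,
      hCb i ⟨x, hxI, h⟩, mul_zero]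
end

section
/- Let a < b be points of I, set Δ := ψ(b)φ(a) − ψ(a)φ(b), k₁(x) := (G(x,b)φ(a) − G(x,a)φ(b))/Δ, k₂(x) := (G(x,a)ψ(b) − G(x,b)ψ(a))/Δ, and h(x,y) := k₁(x)ψ(y) + k₂(x)φ(y). Then for every x ∈ I: h(x,a) = G(x,a), h(x,b) = G(x,b), h(x,y) ≤ G(x,y) for every y ∈ (a,b), and h(x,y) ≥ G(x,y) for every y ∈ I \ (a,b). -/
open Set

/-- For `a < b` in `I` and `h(x,y) = k₁(x)ψ(y) + k₂(x)φ(y)`, one has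
`h(x,a) = G(x,a)`, `h(x,b) = G(x,b)`, `h(x,y) ≤ G(x,y)` on `(a,b)` and
`h(x,y) ≥ G(x,y)` on `I \ (a,b)`. -/
theorem stmt_3 (l r : EReal) (hlr : l < r)
    (I : Set ℝ) (hI : I = {x : ℝ | l < (x : EReal) ∧ (x : EReal) < r})
    (ψ φ : ℝ → ℝ) (w : ℝ) (hw : 0 < w)
    (hψc : ContinuousOn ψ I) (hψ0 : ∀ x ∈ I, 0 < ψ x) (hψm : StrictMonoOn ψ I)
    (hφc : ContinuousOn φ I) (hφ0 : ∀ x ∈ I, 0 < φ x) (hφa : StrictAntiOn φ I)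
    (G : ℝ → ℝ → ℝ)
    (hG : ∀ x y, G x y = if x ≤ y then w⁻¹ * ψ x * φ y else w⁻¹ * ψ y * φ x)
    (a b : ℝ) (ha : a ∈ I) (hb : b ∈ I) (hab : a < b)
    (Δ : ℝ) (hΔ : Δ = ψ b * φ a - ψ a * φ b)
    (k₁ k₂ : ℝ → ℝ)
    (hk₁ : ∀ x, k₁ x = (G x b * φ a - G x a * φ b) / Δ)
    (hk₂ : ∀ x, k₂ x = (G x a * ψ b - G x b * ψ a) / Δ)
    (h : ℝ → ℝ → ℝ) (hh : ∀ x y, h x y = k₁ x * ψ y + k₂ x * φ y)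
    (x : ℝ) (hx : x ∈ I) :
    h x a = G x a ∧ h x b = G x b ∧
    (∀ y ∈ Ioo a b, h x y ≤ G x y) ∧
    (∀ y ∈ I \ Ioo a b, G x y ≤ h x y) := by
  have hD : ∀ s ∈ I, ∀ t ∈ I, s ≤ t → 0 ≤ ψ t * φ s - ψ s * φ t := fun s hs t ht hst =>
    sub_nonneg.2 <| mul_le_mul (hψm.monotoneOn hs ht hst) (hφa.antitoneOn hs ht hst)
      (hφ0 t ht).le (hψ0 t ht).le
  have hΔ0 : 0 < Δ := by
    rw [hΔ]
    exact sub_pos.2 <| mul_lt_mul (hψm ha hb hab) (hφa ha hb hab).le (hφ0 b hb) (hψ0 b hb).le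
  have hw0 : 0 < w⁻¹ := inv_pos.2 hw
  have hIoo : ∀ y ∈ Ioo a b, y ∈ I := by
    rw [hI] at ha hb ⊢
    exact fun y hy => ⟨ha.1.trans (EReal.coe_lt_coe_iff.2 hy.1),
      (EReal.coe_lt_coe_iff.2 hy.2).trans hb.2⟩
  have hG₁ : ∀ y, x ≤ y → G x y = w⁻¹ * ψ x * φ y := fun y hxy => by rw [hG, if_pos hxy]
  have hG₂ : ∀ y, y ≤ x → G x y = w⁻¹ * ψ y * φ x := fun y hyx => by
    rcases hyx.lt_or_eq with hlt | rfl
    · rw [hG, if_neg hlt.not_ge]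
    · rw [hG, if_pos le_rfl]
  have hmul : ∀ y, h x y * Δ =
      G x a * (ψ b * φ y - ψ y * φ b) + G x b * (ψ y * φ a - ψ a * φ y) := fun y => by
    rw [hh, hk₁, hk₂]
    field_simp
    ring
  refine ⟨mul_right_cancel₀ hΔ0.ne' ?_, mul_right_cancel₀ hΔ0.ne' ?_, fun y hy => ?_,
    fun y hy => ?_⟩
  · rw [hmul, hΔ]; ring
  · rw [hmul, hΔ]; ring
  all_goals
    refine le_of_mul_le_mul_right ?_ hΔ0
    rw [hmul, hΔ]
  · have hyI := hIoo y hy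
    rcases le_total x a with hxa | hax
    · rw [hG₁ a hxa, hG₁ b (hxa.trans hab.le), hG₁ y (hxa.trans hy.1.le)]
      exact le_of_eq (by ring)
    rcases le_total b x with hbx | hxb
    · rw [hG₂ a hax, hG₂ b hbx, hG₂ y (hy.2.le.trans hbx)]
      exact le_of_eq (by ring)
    rw [hG₂ a hax, hG₁ b hxb]
    rcases le_total x y with hxy | hyx
    · rw [hG₁ y hxy]
      linear_combination w⁻¹ * mul_nonneg (hD a ha x hx hax) (hD y hyI b hb hy.2.le)
    · rw [hG₂ y hyx]
      linear_combination w⁻¹ * mul_nonneg (hD x hx b hb hxb) (hD a ha y hyI hy.1.le)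
  · obtain ⟨hyI, hy⟩ := hy
    have hΔ' : 0 ≤ ψ b * φ a - ψ a * φ b := hΔ ▸ hΔ0.le
    rcases le_total x a with hxa | hax
    · rw [hG₁ a hxa, hG₁ b (hxa.trans hab.le)]
      rcases le_total x y with hxy | hyx
      · rw [hG₁ y hxy]
        exact le_of_eq (by ring)
      · rw [hG₂ y hyx]
        linear_combination w⁻¹ * mul_nonneg (hD y hyI x hx hyx) hΔ'
    rcases le_total b x with hbx | hxb
    · rw [hG₂ a hax, hG₂ b hbx]
      rcases le_total x y with hxy | hyx
      · rw [hG₁ y hxy]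
        linear_combination w⁻¹ * mul_nonneg (hD x hx y hyI hxy) hΔ'
      · rw [hG₂ y hyx]
        exact le_of_eq (by ring)
    rw [hG₂ a hax, hG₁ b hxb]
    rcases le_or_gt y a with hya | hay
    · rw [hG₂ y (hya.trans hax)]
      linear_combination w⁻¹ * mul_nonneg (hD x hx b hb hxb) (hD y hyI a ha hya)
    · have hby : b ≤ y := not_lt.1 fun hlt => hy ⟨hay, hlt⟩
      rw [hG₁ y (hxb.trans hby)]
      linear_combination w⁻¹ * mul_nonneg (hD a ha x hx hax) (hD b hb y hyI hby)
end

section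
/- Let C ⊆ I be an interval, c ∈ C, and let μ be a signed Borel measure on C with ∫_C ψ d|μ| < ∞. Suppose that the restriction of μ to {y ∈ C : y ≤ c} is a nonpositive measure, the restriction of μ to {y ∈ C : y > c} is a nonnegative measure, and ∫_C ψ dμ ≤ 0. Then for every x ∈ I, ∫_C G(x,y) μ(dy) ≤ 0. -/
open Set MeasureTheory

/-- The ratio `G(x, ·) / ψ` of the Green kernel to the increasing factor is nonincreasing,
stated without division. -/
lemma greenKernel_mul_le {I : Set ℝ} {ψ φ : ℝ → ℝ} {w : ℝ} (hw : 0 < w)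
    (hψ0 : ∀ x ∈ I, 0 < ψ x) (hψm : MonotoneOn ψ I)
    (hφ0 : ∀ x ∈ I, 0 < φ x) (hφa : AntitoneOn φ I) {G : ℝ → ℝ → ℝ}
    (hG : ∀ x y, G x y = if x ≤ y then w⁻¹ * ψ x * φ y else w⁻¹ * ψ y * φ x)
    {x a b : ℝ} (hx : x ∈ I) (ha : a ∈ I) (hb : b ∈ I) (hab : a ≤ b) :
    ψ a * G x b ≤ ψ b * G x a := by
  have hw' : 0 ≤ w⁻¹ := (inv_pos.2 hw).le
  have hψx := (hψ0 x hx).le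
  have hψa := (hψ0 a ha).le
  have hψb := (hψ0 b hb).le
  have hφb := (hφ0 b hb).le
  rw [hG, hG]
  rcases le_or_gt x a with hxa | hax
  · rw [if_pos (hxa.trans hab), if_pos hxa]
    have hψ := hψm ha hb hab
    have hφ := hφa ha hb hab
    gcongr
  · rw [if_neg hax.not_ge]
    rcases le_or_gt x b with hxb | hbx
    · rw [if_pos hxb]
      have hψ := hψm hx hb hxb
      have hφ := hφa hx hb hxb
      calc ψ a * (w⁻¹ * ψ x * φ b) ≤ ψ a * (w⁻¹ * ψ b * φ x) := by gcongr
        _ = ψ b * (w⁻¹ * ψ a * φ x) := by ring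
    · rw [if_neg hbx.not_ge]
      exact le_of_eq (by ring)

/-- if the signed measure `μ(dy) = f(y)ρ(dy)` on the interval `C ⊆ I`
is nonpositive on `{y ∈ C : y ≤ c}`, nonnegative on `{y ∈ C : y > c}`, with
`∫_C ψ d|μ| < ∞` and `∫_C ψ dμ ≤ 0`, then `∫_C G(x,y) μ(dy) ≤ 0` for every `x ∈ I`. -/
theorem stmt_4 (l r : EReal) (hlr : l < r)
    (I : Set ℝ) (hI : I = {x : ℝ | l < (x : EReal) ∧ (x : EReal) < r})
    (ψ φ : ℝ → ℝ) (w : ℝ) (hw : 0 < w)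
    (hψc : ContinuousOn ψ I) (hψ0 : ∀ x ∈ I, 0 < ψ x) (hψm : StrictMonoOn ψ I)
    (hφc : ContinuousOn φ I) (hφ0 : ∀ x ∈ I, 0 < φ x) (hφa : StrictAntiOn φ I)
    (G : ℝ → ℝ → ℝ)
    (hG : ∀ x y, G x y = if x ≤ y then w⁻¹ * ψ x * φ y else w⁻¹ * ψ y * φ x)
    (C : Set ℝ) (hCI : C ⊆ I) (hCord : C.OrdConnected) (c : ℝ) (hc : c ∈ C)
    (ρ : Measure ℝ) (f : ℝ → ℝ) (hf : Measurable f)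
    (hint : IntegrableOn (fun y => ψ y * |f y|) C ρ)
    (hneg : ∀ᵐ y ∂(ρ.restrict (C ∩ {y | y ≤ c})), f y ≤ 0)
    (hpos : ∀ᵐ y ∂(ρ.restrict (C ∩ {y | c < y})), 0 ≤ f y)
    (hψμ : (∫ y in C, ψ y * f y ∂ρ) ≤ 0) :
    ∀ x ∈ I, (∫ y in C, G x y * f y ∂ρ) ≤ 0 := by
  intro x hx
  have hcI := hCI hc
  have hCm : MeasurableSet C := hCord.measurableSet
  by_cases hGi : IntegrableOn (fun y => G x y * f y) C ρ
  swap
  · exact (integral_undef hGi).le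
  have hψf : IntegrableOn (fun y => ψ y * f y) C ρ := by
    refine Integrable.mono hint
      (((hψc.mono hCI).aestronglyMeasurable hCm).mul hf.aestronglyMeasurable) ?_
    exact Filter.Eventually.of_forall fun y => by simp
  have hGc : 0 ≤ G x c := by
    have hψx := hψ0 x hx
    have hφx := hφ0 x hx
    have hψc := hψ0 c hcI
    have hφc := hφ0 c hcI
    rw [hG]
    split_ifs <;> positivity
  replace hneg := (ae_restrict_iff' (hCm.inter measurableSet_Iic)).1 hneg
  replace hpos := (ae_restrict_iff' (hCm.inter measurableSet_Ioi)).1 hpos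
  have hle : ∫ y in C, ψ c * (G x y * f y) ∂ρ ≤ ∫ y in C, G x c * (ψ y * f y) ∂ρ := by
    refine setIntegral_mono_ae_restrict (hGi.const_mul _) (hψf.const_mul _) ?_
    rw [Filter.EventuallyLE, ae_restrict_iff' hCm]
    filter_upwards [hneg, hpos] with y hyneg hypos hyC
    rcases le_or_gt y c with hyc | hcy
    · have key := greenKernel_mul_le hw hψ0 hψm.monotoneOn hφ0 hφa.antitoneOn hG hx
        (hCI hyC) hcI hyc
      linarith [mul_le_mul_of_nonpos_right key (hyneg ⟨hyC, hyc⟩)]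
    · have key := greenKernel_mul_le hw hψ0 hψm.monotoneOn hφ0 hφa.antitoneOn hG hx
        hcI (hCI hyC) hcy.le
      linarith [mul_le_mul_of_nonneg_right key (hypos ⟨hyC, hcy⟩)]
  rw [integral_const_mul, integral_const_mul] at hle
  exact nonpos_of_mul_nonpos_right
    (hle.trans (mul_nonpos_of_nonneg_of_nonpos hGc hψμ)) (hψ0 c hcI)
end

section
/- Let C ⊆ I be an interval, c ∈ C, and let μ be a signed Borel measure on C with ∫_C φ d|μ| < ∞. Suppose that the restriction of μ to {y ∈ C : y < c} is a nonnegative measure, the restriction of μ to {y ∈ C : y ≥ c} is a nonpositive measure, and ∫_C φ dμ ≤ 0. Then for every x ∈ I, ∫_C G(x,y) μ(dy) ≤ 0. -/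
open Set MeasureTheory

/-- The ratio `G x y / φ y` of a Green kernel to its decreasing factor is nondecreasing in `y`,
stated in cross-multiplied form. -/
theorem green_mul_le_green_mul {I : Set ℝ} {ψ φ : ℝ → ℝ} {w : ℝ} (hw : 0 < w)
    (hψ0 : ∀ x ∈ I, 0 < ψ x) (hψm : MonotoneOn ψ I)
    (hφ0 : ∀ x ∈ I, 0 < φ x) (hφa : AntitoneOn φ I) {G : ℝ → ℝ → ℝ}
    (hG : ∀ x y, G x y = if x ≤ y then w⁻¹ * ψ x * φ y else w⁻¹ * ψ y * φ x)
    {x y z : ℝ} (hx : x ∈ I) (hy : y ∈ I) (hz : z ∈ I) (hyz : y ≤ z) :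
    G x y * φ z ≤ G x z * φ y := by
  have hw' : 0 < w⁻¹ := inv_pos.mpr hw
  have hψx := hψ0 x hx
  have hψz := hψ0 z hz
  have hφx := hφ0 x hx
  have hφy := hφ0 y hy
  have hφz := hφ0 z hz
  rw [hG, hG]
  rcases le_or_gt x y with hxy | hyx
  · rw [if_pos hxy, if_pos (hxy.trans hyz)]
    exact le_of_eq (by ring)
  · rw [if_neg hyx.not_ge]
    split_ifs with hxz
    · calc w⁻¹ * ψ y * φ x * φ z ≤ w⁻¹ * ψ x * φ y * φ z := by
            gcongr
            · exact hψm hy hx hyx.le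
            · exact hφa hy hx hyx.le
        _ = w⁻¹ * ψ x * φ z * φ y := by ring
    · gcongr
      · exact hψm hy hz hyz
      · exact hφa hy hz hyz

/-- if the signed measure `μ(dy) = f(y)ρ(dy)` on the interval `C ⊆ I`
is nonnegative on `{y ∈ C : y < c}`, nonpositive on `{y ∈ C : y ≥ c}`, with
`∫_C φ d|μ| < ∞` and `∫_C φ dμ ≤ 0`, then `∫_C G(x,y) μ(dy) ≤ 0` for every `x ∈ I`. -/
theorem stmt_5 (l r : EReal) (hlr : l < r)
    (I : Set ℝ) (hI : I = {x : ℝ | l < (x : EReal) ∧ (x : EReal) < r})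
    (ψ φ : ℝ → ℝ) (w : ℝ) (hw : 0 < w)
    (hψc : ContinuousOn ψ I) (hψ0 : ∀ x ∈ I, 0 < ψ x) (hψm : StrictMonoOn ψ I)
    (hφc : ContinuousOn φ I) (hφ0 : ∀ x ∈ I, 0 < φ x) (hφa : StrictAntiOn φ I)
    (G : ℝ → ℝ → ℝ)
    (hG : ∀ x y, G x y = if x ≤ y then w⁻¹ * ψ x * φ y else w⁻¹ * ψ y * φ x)
    (C : Set ℝ) (hCI : C ⊆ I) (hCord : C.OrdConnected) (c : ℝ) (hc : c ∈ C)
    (ρ : Measure ℝ) (f : ℝ → ℝ) (hf : Measurable f)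
    (hint : IntegrableOn (fun y => φ y * |f y|) C ρ)
    (hpos : ∀ᵐ y ∂(ρ.restrict (C ∩ {y | y < c})), 0 ≤ f y)
    (hneg : ∀ᵐ y ∂(ρ.restrict (C ∩ {y | c ≤ y})), f y ≤ 0)
    (hφμ : (∫ y in C, φ y * f y ∂ρ) ≤ 0) :
    ∀ x ∈ I, (∫ y in C, G x y * f y ∂ρ) ≤ 0 := by
  intro x hx
  have hCm : MeasurableSet C := hCord.measurableSet
  by_cases hGint : IntegrableOn (fun y => G x y * f y) C ρ
  swap
  · exact (integral_undef hGint).le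
  have hφf : IntegrableOn (fun y => φ y * f y) C ρ := by
    refine Integrable.mono hint
      (((hφc.mono hCI).aestronglyMeasurable hCm).mul hf.aestronglyMeasurable) ?_
    exact Filter.Eventually.of_forall fun y => by simp
  have hGc : 0 ≤ G x c := by
    have := hψ0 x hx
    have := hψ0 c (hCI hc)
    have := hφ0 x hx
    have := hφ0 c (hCI hc)
    rw [hG]
    split_ifs <;> positivity
  replace hpos := (ae_restrict_iff' (hCm.inter measurableSet_Iio)).mp hpos
  replace hneg := (ae_restrict_iff' (hCm.inter measurableSet_Ici)).mp hneg
  have hle : ∀ᵐ y ∂(ρ.restrict C), φ c * (G x y * f y) ≤ G x c * (φ y * f y) := by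
    rw [ae_restrict_iff' hCm]
    filter_upwards [hpos, hneg] with y hyp hyn hy
    rw [← mul_assoc, ← mul_assoc, mul_comm (φ c)]
    rcases lt_or_ge y c with hyc | hcy
    · exact mul_le_mul_of_nonneg_right
        (green_mul_le_green_mul hw hψ0 hψm.monotoneOn hφ0 hφa.antitoneOn hG hx (hCI hy) (hCI hc)
          hyc.le) (hyp ⟨hy, hyc⟩)
    · exact mul_le_mul_of_nonpos_right
        (green_mul_le_green_mul hw hψ0 hψm.monotoneOn hφ0 hφa.antitoneOn hG hx (hCI hc) (hCI hy)
          hcy) (hyn ⟨hy, hcy⟩)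
  have hmono := integral_mono_ae (hGint.const_mul (φ c)) (hφf.const_mul (G x c)) hle
  rw [integral_const_mul, integral_const_mul] at hmono
  exact nonpos_of_mul_nonpos_right
    (hmono.trans (mul_nonpos_of_nonneg_of_nonpos hGc hφμ)) (hφ0 c (hCI hc))
end

section
/- Let a < b be points of I, let C ⊆ I be an interval containing [a,b], and let μ be a signed Borel measure on C with ∫_C ψ d|μ| < ∞ and ∫_C φ d|μ| < ∞. Suppose the restriction of μ to (a,b) is a nonpositive measure, the restriction of μ to C \ (a,b) is a nonnegative measure, ∫_C ψ dμ ≤ 0 and ∫_C φ dμ ≤ 0. Then for every x ∈ I, ∫_C G(x,y) μ(dy) ≤ 0. -/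
open Set MeasureTheory

/-- If `f ≤ 0` on `s`, `f ≥ 0` on `C \ s`, and `k` lies above a nonnegative combination
`α ψ + β φ` on `s` and below it on `C \ s`, then `∫_C k f ≤ 0` as soon as `∫_C ψ f ≤ 0` and
`∫_C φ f ≤ 0`. -/
theorem setIntegral_mul_nonpos_of_crossing {X : Type*} [MeasurableSpace X] {ρ : Measure X}
    {C s : Set X} (hC : MeasurableSet C) (hs : MeasurableSet s) {f k ψ φ : X → ℝ} {α β : ℝ}
    (hα : 0 ≤ α) (hβ : 0 ≤ β)
    (hintψ : IntegrableOn (fun y => ψ y * f y) C ρ)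
    (hintφ : IntegrableOn (fun y => φ y * f y) C ρ)
    (hneg : ∀ᵐ y ∂(ρ.restrict s), f y ≤ 0)
    (hpos : ∀ᵐ y ∂(ρ.restrict (C \ s)), 0 ≤ f y)
    (hψμ : (∫ y in C, ψ y * f y ∂ρ) ≤ 0) (hφμ : (∫ y in C, φ y * f y ∂ρ) ≤ 0)
    (hin : ∀ y ∈ C, y ∈ s → α * ψ y + β * φ y ≤ k y)
    (hout : ∀ y ∈ C, y ∉ s → k y ≤ α * ψ y + β * φ y) :
    (∫ y in C, k y * f y ∂ρ) ≤ 0 := by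
  by_cases hk : IntegrableOn (fun y => k y * f y) C ρ
  · have hle : (∫ y in C, k y * f y ∂ρ)
        ≤ ∫ y in C, (α * (ψ y * f y) + β * (φ y * f y)) ∂ρ := by
      refine integral_mono_ae hk ((hintψ.const_mul α).add (hintφ.const_mul β)) ?_
      rw [ae_restrict_iff' hs] at hneg
      rw [ae_restrict_iff' (hC.diff hs)] at hpos
      refine (ae_restrict_iff' hC).2 ?_
      filter_upwards [hneg, hpos] with y hy₁ hy₂ hyC
      by_cases hys : y ∈ s
      · linarith [mul_le_mul_of_nonpos_right (hin y hyC hys) (hy₁ hys)]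
      · linarith [mul_le_mul_of_nonneg_right (hout y hyC hys) (hy₂ ⟨hyC, hys⟩)]
    rw [integral_add (hintψ.const_mul α) (hintφ.const_mul β), integral_const_mul,
      integral_const_mul] at hle
    linarith [mul_nonpos_of_nonneg_of_nonpos hα hψμ, mul_nonpos_of_nonneg_of_nonpos hβ hφμ]
  · rw [integral_undef hk]

/-- A continuous weight integrable against `|f|` is integrable against `f`. -/
theorem ContinuousOn.integrableOn_mul_of_abs {ρ : Measure ℝ} {C : Set ℝ} (hC : MeasurableSet C)
    {f g : ℝ → ℝ} (hf : Measurable f) (hg : ContinuousOn g C)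
    (h : IntegrableOn (fun y => g y * |f y|) C ρ) :
    IntegrableOn (fun y => g y * f y) C ρ := by
  refine Integrable.mono h ((hg.aestronglyMeasurable hC).mul hf.aestronglyMeasurable) ?_
  simp

/-- The Green kernel `G(x, ·)` lies above some nonnegative combination `α ψ + β φ` on `(a, b)` and
below it off `(a, b)`. -/
theorem exists_nonneg_combination_crossing_green {I : Set ℝ} {ψ φ : ℝ → ℝ} {w : ℝ} (hw : 0 < w)
    (hψ0 : ∀ x ∈ I, 0 < ψ x) (hψm : StrictMonoOn ψ I)
    (hφ0 : ∀ x ∈ I, 0 < φ x) (hφa : StrictAntiOn φ I) {G : ℝ → ℝ → ℝ}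
    (hG : ∀ x y, G x y = if x ≤ y then w⁻¹ * ψ x * φ y else w⁻¹ * ψ y * φ x)
    {a b : ℝ} (ha : a ∈ I) (hb : b ∈ I) (hab : a < b) {x : ℝ} (hx : x ∈ I) :
    ∃ α β : ℝ, 0 ≤ α ∧ 0 ≤ β ∧
      (∀ y ∈ I, y ∈ Ioo a b → α * ψ y + β * φ y ≤ G x y) ∧
      (∀ y ∈ I, y ∉ Ioo a b → G x y ≤ α * ψ y + β * φ y) := by
  have hw' : 0 < w⁻¹ := inv_pos.2 hw
  have cross : ∀ u ∈ I, ∀ v ∈ I, u ≤ v → 0 ≤ ψ v * φ u - ψ u * φ v := fun u hu v hv huv =>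
    sub_nonneg.2 (mul_le_mul (hψm.monotoneOn hu hv huv) (hφa.antitoneOn hu hv huv)
      (hφ0 v hv).le (hψ0 v hv).le)
  rcases le_or_gt x a with hxa | hxa
  · refine ⟨0, w⁻¹ * ψ x, le_rfl, (mul_pos hw' (hψ0 x hx)).le, ?_, ?_⟩
    · intro y _ hys
      rw [hG, if_pos (hxa.trans hys.1.le)]
      linarith
    · intro y hy _
      rw [hG]
      split_ifs with hxy
      · linarith
      · linarith [mul_nonneg hw'.le (cross y hy x hx (not_le.1 hxy).le)]
  rcases le_or_gt b x with hbx | hxb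
  · refine ⟨w⁻¹ * φ x, 0, (mul_pos hw' (hφ0 x hx)).le, le_rfl, ?_, ?_⟩
    · intro y _ hys
      rw [hG, if_neg (not_le.2 (hys.2.trans_le hbx))]
      linarith
    · intro y hy _
      rw [hG]
      split_ifs with hxy
      · linarith [mul_nonneg hw'.le (cross x hx y hy hxy)]
      · linarith
  have hD : 0 < ψ b * φ a - ψ a * φ b :=
    sub_pos.2 (mul_lt_mul (hψm ha hb hab) (hφa ha hb hab).le (hφ0 b hb) (hψ0 b hb).le)
  have hA := cross a ha x hx hxa.le
  have hB := cross x hx b hb hxb.le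
  set D := ψ b * φ a - ψ a * φ b with hDdef
  set A := ψ x * φ a - ψ a * φ x with hAdef
  set B := ψ b * φ x - ψ x * φ b with hBdef
  have hwD : 0 < w⁻¹ / D := div_pos hw' hD
  -- On each side of `x` the difference is a multiple of a cross product vanishing at `a` or `b`.
  have right : ∀ y, w⁻¹ / D * (φ b * A) * ψ y + w⁻¹ / D * (ψ a * B) * φ y - w⁻¹ * ψ x * φ y
      = w⁻¹ / D * (A * (ψ y * φ b - ψ b * φ y)) := by
    intro y
    have hc : w⁻¹ * ψ x * φ y = w⁻¹ / D * (D * (ψ x * φ y)) := by field_simp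
    rw [hc, hDdef, hAdef, hBdef]
    ring
  have left : ∀ y, w⁻¹ / D * (φ b * A) * ψ y + w⁻¹ / D * (ψ a * B) * φ y - w⁻¹ * ψ y * φ x
      = w⁻¹ / D * (B * (ψ a * φ y - ψ y * φ a)) := by
    intro y
    have hc : w⁻¹ * ψ y * φ x = w⁻¹ / D * (D * (ψ y * φ x)) := by field_simp
    rw [hc, hDdef, hAdef, hBdef]
    ring
  refine ⟨w⁻¹ / D * (φ b * A), w⁻¹ / D * (ψ a * B),
    mul_nonneg hwD.le (mul_nonneg (hφ0 b hb).le hA),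
    mul_nonneg hwD.le (mul_nonneg (hψ0 a ha).le hB), ?_, ?_⟩
  · intro y hy hys
    rw [hG, ← sub_nonpos]
    split_ifs with hxy
    · rw [right]
      exact mul_nonpos_of_nonneg_of_nonpos hwD.le (mul_nonpos_of_nonneg_of_nonpos hA
        (by linarith [cross y hy b hb hys.2.le]))
    · rw [left]
      exact mul_nonpos_of_nonneg_of_nonpos hwD.le (mul_nonpos_of_nonneg_of_nonpos hB
        (by linarith [cross a ha y hy hys.1.le]))
  · intro y hy hys
    rw [hG, ← sub_nonneg]
    split_ifs with hxy
    · have hby : b ≤ y := not_lt.1 fun h => hys ⟨hxa.trans_le hxy, h⟩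
      rw [right]
      exact mul_nonneg hwD.le (mul_nonneg hA (cross b hb y hy hby))
    · have hya : y ≤ a := not_lt.1 fun h => hys ⟨h, (not_le.1 hxy).trans hxb⟩
      rw [left]
      exact mul_nonneg hwD.le (mul_nonneg hB (cross y hy a ha hya))

/-- if the signed measure `μ(dy) = f(y)ρ(dy)` on the interval `C ⊇ [a,b]`
is nonpositive on `(a,b)`, nonnegative on `C \ (a,b)`, with `∫_C ψ d|μ| < ∞`,
`∫_C φ d|μ| < ∞`, `∫_C ψ dμ ≤ 0` and `∫_C φ dμ ≤ 0`, then `∫_C G(x,y) μ(dy) ≤ 0`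
for every `x ∈ I`. -/
theorem stmt_6 (l r : EReal) (hlr : l < r)
    (I : Set ℝ) (hI : I = {x : ℝ | l < (x : EReal) ∧ (x : EReal) < r})
    (ψ φ : ℝ → ℝ) (w : ℝ) (hw : 0 < w)
    (hψc : ContinuousOn ψ I) (hψ0 : ∀ x ∈ I, 0 < ψ x) (hψm : StrictMonoOn ψ I)
    (hφc : ContinuousOn φ I) (hφ0 : ∀ x ∈ I, 0 < φ x) (hφa : StrictAntiOn φ I)
    (G : ℝ → ℝ → ℝ)
    (hG : ∀ x y, G x y = if x ≤ y then w⁻¹ * ψ x * φ y else w⁻¹ * ψ y * φ x)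
    (a b : ℝ) (ha : a ∈ I) (hb : b ∈ I) (hab : a < b)
    (C : Set ℝ) (hCI : C ⊆ I) (hCord : C.OrdConnected) (habC : Icc a b ⊆ C)
    (ρ : Measure ℝ) (f : ℝ → ℝ) (hf : Measurable f)
    (hintψ : IntegrableOn (fun y => ψ y * |f y|) C ρ)
    (hintφ : IntegrableOn (fun y => φ y * |f y|) C ρ)
    (hneg : ∀ᵐ y ∂(ρ.restrict (Ioo a b)), f y ≤ 0)
    (hpos : ∀ᵐ y ∂(ρ.restrict (C \ Ioo a b)), 0 ≤ f y)
    (hψμ : (∫ y in C, ψ y * f y ∂ρ) ≤ 0)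
    (hφμ : (∫ y in C, φ y * f y ∂ρ) ≤ 0) :
    ∀ x ∈ I, (∫ y in C, G x y * f y ∂ρ) ≤ 0 := by
  intro x hx
  have hC : MeasurableSet C := hCord.measurableSet
  obtain ⟨α, β, hα, hβ, hin, hout⟩ :=
    exists_nonneg_combination_crossing_green hw hψ0 hψm hφ0 hφa hG ha hb hab hx
  exact setIntegral_mul_nonpos_of_crossing hC measurableSet_Ioo hα hβ
    ((hψc.mono hCI).integrableOn_mul_of_abs hC hf hintψ)
    ((hφc.mono hCI).integrableOn_mul_of_abs hC hf hintφ) hneg hpos hψμ hφμ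
    (fun y hy => hin y (hCI hy)) (fun y hy => hout y (hCI hy))
end

section
/- For every x ∈ ℝ, g(x) = (1/√2) ∫_ℝ e^{−√2·|x−y|} g(y) dy + (1/√2) e^{−√2·|x−1|} − (1/√2) e^{−√2·|x−2|}. In other words, g(x) = ∫_ℝ G₁(x,y) ν(dy), where G₁(x,y) = e^{−√2·|x−y|}/(2√2) and ν is the signed measure ν(dy) = 2 g(y) dy + 2δ₁(dy) − 2δ₂(dy), δ_a denoting the Dirac measure at a. -/
open MeasureTheory Real

/-- The continuous piecewise-linear reward: `g(x) = x` for `x < 1`, `g(x) = 2 − x` for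
`1 ≤ x ≤ 2`, and `g(x) = x − 2` for `x > 2`. -/
noncomputable def gReward (x : ℝ) : ℝ :=
  if x < 1 then x else if x ≤ 2 then 2 - x else x - 2

/-- Exponential tail integral of a nonnegative affine function, with its integrability. -/
lemma exp_mul_affine_Ioi {c a b : ℝ} (hc : 0 < c) (hab : a ≤ b) (x : ℝ) :
    IntegrableOn (fun y => exp (-c * (y - x)) * (y - a)) (Set.Ioi b) ∧
      ∫ y in Set.Ioi b, exp (-c * (y - x)) * (y - a) =
        exp (-c * (b - x)) * ((b - a) / c + 1 / c ^ 2) := by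
  have hderiv : ∀ y ∈ Set.Ici b,
      HasDerivAt (fun y => -(exp (-c * (y - x)) * ((y - a) / c + 1 / c ^ 2)))
        (exp (-c * (y - x)) * (y - a)) y := by
    intro y _
    have h1 : HasDerivAt (fun y => exp (-c * (y - x))) (exp (-c * (y - x)) * (-c * 1)) y :=
      (((hasDerivAt_id y).sub_const x).const_mul (-c)).exp
    have h2 : HasDerivAt (fun y => (y - a) / c + 1 / c ^ 2) (1 / c) y :=
      (((hasDerivAt_id y).sub_const a).div_const c).add_const _
    refine (h1.mul h2).neg.congr_deriv ?_
    field_simp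
    ring
  have hnonneg : ∀ y ∈ Set.Ioi b, 0 ≤ exp (-c * (y - x)) * (y - a) := fun y hy =>
    mul_nonneg (exp_pos _).le (sub_nonneg.2 (hab.trans (le_of_lt hy)))
  have hlim : Filter.Tendsto (fun y => -(exp (-c * (y - x)) * ((y - a) / c + 1 / c ^ 2)))
      Filter.atTop (nhds 0) := by
    have h0 := tendsto_rpow_mul_exp_neg_mul_atTop_nhds_zero 0 c hc
    have h1 := tendsto_rpow_mul_exp_neg_mul_atTop_nhds_zero 1 c hc
    have h := (h1.const_mul (-(exp (c * x) / c))).add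
      (h0.const_mul (exp (c * x) * (a / c - 1 / c ^ 2)))
    simp only [mul_zero, add_zero] at h
    refine h.congr fun y => ?_
    rw [rpow_one, rpow_zero, show -c * (y - x) = c * x + -c * y by ring, exp_add]
    ring
  refine ⟨integrableOn_Ioi_deriv_of_nonneg' hderiv hnonneg hlim, ?_⟩
  rw [integral_Ioi_of_hasDerivAt_of_nonneg' hderiv hnonneg hlim]
  ring

/-- Integral of an affine function against a growing exponential on a bounded interval. -/
lemma exp_mul_affine_interval {c : ℝ} (hc : 0 < c) (a x : ℝ) :
    ∫ y in a..x, exp (-c * (x - y)) * (y - a) =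
      (x - a) / c - 1 / c ^ 2 + exp (-c * (x - a)) / c ^ 2 := by
  have hderiv : ∀ y ∈ Set.uIcc a x,
      HasDerivAt (fun y => exp (-c * (x - y)) * ((y - a) / c - 1 / c ^ 2))
        (exp (-c * (x - y)) * (y - a)) y := by
    intro y _
    have h1 : HasDerivAt (fun y => exp (-c * (x - y))) (exp (-c * (x - y)) * (-c * -1)) y :=
      (((hasDerivAt_id y).const_sub x).const_mul (-c)).exp
    have h2 : HasDerivAt (fun y => (y - a) / c - 1 / c ^ 2) (1 / c) y :=
      (((hasDerivAt_id y).sub_const a).div_const c).sub_const _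
    refine (h1.mul h2).congr_deriv ?_
    field_simp
    ring
  rw [intervalIntegral.integral_eq_sub_of_hasDerivAt hderiv
    (Continuous.intervalIntegrable (by fun_prop) _ _)]
  simp
  ring

/-- The two-sided exponential kernel applied to the positive part `(y - a)⁺`. -/
lemma exp_abs_mul_posPart {c : ℝ} (hc : 0 < c) (a x : ℝ) :
    Integrable (fun y => exp (-c * |x - y|) * max (y - a) 0) ∧
      ∫ y, exp (-c * |x - y|) * max (y - a) 0 =
        2 / c * max (x - a) 0 + exp (-c * |x - a|) / c ^ 2 := by
  set f : ℝ → ℝ := fun y => exp (-c * |x - y|) * max (y - a) 0 with hf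
  have hzero : ∀ y, y ∉ Set.Ioi a → f y = 0 := fun y hy => by
    have : y - a ≤ 0 := sub_nonpos.2 (not_lt.1 hy)
    simp [hf, max_eq_right this]
  have hcont : Continuous f := by fun_prop
  have htail : ∀ b, a ≤ b → x ≤ b →
      Set.EqOn (fun y => exp (-c * (y - x)) * (y - a)) f (Set.Ioi b) := by
    intro b hab hxb y hy
    have hy : b < y := hy
    simp only [hf]
    rw [max_eq_left (by linarith), abs_of_nonpos (by linarith), neg_sub]
  have hInt : ∀ b, a ≤ b → x ≤ b → IntegrableOn f (Set.Ioi b) := fun b hab hxb =>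
    (exp_mul_affine_Ioi hc hab x).1.congr_fun (htail b hab hxb) measurableSet_Ioi
  have hVal : ∀ b, a ≤ b → x ≤ b →
      ∫ y in Set.Ioi b, f y = exp (-c * (b - x)) * ((b - a) / c + 1 / c ^ 2) :=
    fun b hab hxb => by
      rw [← (exp_mul_affine_Ioi hc hab x).2]
      exact (setIntegral_congr_fun measurableSet_Ioi (htail b hab hxb)).symm
  rw [← integrableOn_iff_integrable_of_support_subset (s := Set.Ioi a)
      (Function.support_subset_iff'.2 hzero),
    ← setIntegral_eq_integral_of_forall_compl_eq_zero hzero]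
  rcases le_total x a with hxa | hax
  · refine ⟨hInt a le_rfl hxa, ?_⟩
    rw [hVal a le_rfl hxa, max_eq_right (by linarith), abs_of_nonpos (by linarith), neg_sub]
    ring
  · have hIoc : IntegrableOn f (Set.Ioc a x) := hcont.integrableOn_Ioc
    have hIoi := hInt x hax le_rfl
    rw [← Set.Ioc_union_Ioi_eq_Ioi hax]
    refine ⟨hIoc.union hIoi, ?_⟩
    rw [setIntegral_union (Set.Ioc_disjoint_Ioi le_rfl) measurableSet_Ioi hIoc hIoi,
      hVal x hax le_rfl, ← intervalIntegral.integral_of_le hax,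
      intervalIntegral.integral_congr (g := fun y => exp (-c * (x - y)) * (y - a)) ?_,
      exp_mul_affine_interval hc, max_eq_left (by linarith), abs_of_nonneg (by linarith)]
    · simp
      ring
    · intro y hy
      rw [Set.uIcc_of_le hax] at hy
      simp only [hf]
      rw [max_eq_left (by linarith [hy.1]), abs_of_nonneg (by linarith [hy.2])]

/-- The two-sided exponential kernel applied to the negative part `y⁻`. -/
lemma exp_abs_mul_negPart {c : ℝ} (hc : 0 < c) (x : ℝ) :
    Integrable (fun y => exp (-c * |x - y|) * max (-y) 0) ∧
      ∫ y, exp (-c * |x - y|) * max (-y) 0 =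
        2 / c * max (-x) 0 + exp (-c * |x|) / c ^ 2 := by
  obtain ⟨hI, hV⟩ := exp_abs_mul_posPart hc 0 (-x)
  have heq : (fun y => exp (-c * |x - y|) * max (-y) 0) =
      fun y => exp (-c * |-x - -y|) * max (-y - 0) 0 := by
    ext y
    rw [sub_zero, ← abs_neg (x - y)]
    congr 4
    ring
  rw [heq, integral_neg_eq_self (fun y => exp (-c * |-x - y|) * max (y - 0) 0), hV]
  exact ⟨hI.comp_neg, by simp⟩

/-- The reward as a combination of positive parts. -/
lemma gReward_eq_posParts (y : ℝ) :
    gReward y = max (y - 0) 0 - max (-y) 0 - 2 * max (y - 1) 0 + 2 * max (y - 2) 0 := by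
  unfold gReward
  grind

/-- for every `x ∈ ℝ`,
`g(x) = (1/√2)∫_ℝ e^{−√2|x−y|} g(y) dy + (1/√2)e^{−√2|x−1|} − (1/√2)e^{−√2|x−2|}`,
i.e. `g(x) = ∫_ℝ G₁(x,y) ν(dy)` with `G₁(x,y) = e^{−√2|x−y|}/(2√2)` and
`ν(dy) = 2 g(y) dy + 2δ₁(dy) − 2δ₂(dy)`. -/
theorem stmt_15 (x : ℝ) :
    gReward x =
      (1 / Real.sqrt 2) * (∫ y : ℝ, Real.exp (-(Real.sqrt 2) * |x - y|) * gReward y) +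
        (1 / Real.sqrt 2) * Real.exp (-(Real.sqrt 2) * |x - 1|) -
        (1 / Real.sqrt 2) * Real.exp (-(Real.sqrt 2) * |x - 2|) := by
  have hc : 0 < √(2 : ℝ) := by positivity
  have hsq : √(2 : ℝ) ^ 2 = 2 := sq_sqrt (by norm_num)
  obtain ⟨i0, v0⟩ := exp_abs_mul_posPart hc 0 x
  obtain ⟨i0', v0'⟩ := exp_abs_mul_negPart hc x
  obtain ⟨i1, v1⟩ := exp_abs_mul_posPart hc 1 x
  obtain ⟨i2, v2⟩ := exp_abs_mul_posPart hc 2 x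
  have hint : ∫ y : ℝ, exp (-√2 * |x - y|) * gReward y =
      (∫ y, exp (-√2 * |x - y|) * max (y - 0) 0) - (∫ y, exp (-√2 * |x - y|) * max (-y) 0)
        - 2 * (∫ y, exp (-√2 * |x - y|) * max (y - 1) 0)
        + 2 * ∫ y, exp (-√2 * |x - y|) * max (y - 2) 0 := by
    rw [← integral_const_mul, ← integral_const_mul, ← integral_sub i0 i0',
      ← integral_sub (by exact i0.sub i0') (i1.const_mul 2),
      ← integral_add (by exact (i0.sub i0').sub (i1.const_mul 2)) (i2.const_mul 2)]
    congr 1 with y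
    rw [gReward_eq_posParts]
    ring
  rw [hint, v0, v0', v1, v2, gReward_eq_posParts, hsq, sub_zero]
  field_simp
  rw [hsq]
  ring
end
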